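/- Let G be a nonempty position. Then: (1) if c(G) ≥ 2 then v(G) = c(G); (2) if c(G) = 0, G contains a 4-loop, and G is not the position consisting of one 4-loop and two 3-chains, then v(G) = 0; (3) if θ(G) = 0, or θ(G) = 1 and size(G) ≡ 3 (mod 4), then v(G) = Φ^{f(G)}(Θ^{θ′(G)}(Σ^{s(G)}(c(G₀)))), where G₀ is the core of G. If none of the hypotheses of (1)–(3) hold, then v(G) = 1 if size(G) is odd and v(G) = 2 if size(G) is even. -/

import Mathlib

namespace DotsAndBoxes

/-- A component of a Dots & Boxes endgame position: an `n`-chain or an `n`-loop. -/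
inductive Component : Type where
  | chain (n : ℕ)
  | loop (n : ℕ)
deriving DecidableEq

namespace Component

/-- The number of boxes in a component. -/
def size : Component → ℕ
  | chain n => n
  | loop n => n

def isChain : Component → Bool
  | chain _ => true
  | loop _ => false

def isLoop : Component → Bool
  | chain _ => false
  | loop _ => true

/-- A chain must have length at least 3; a loop must have even length at least 4. -/
def Valid : Component → Prop
  | chain n => 3 ≤ n
  | loop n => 4 ≤ n ∧ Even n

end Component

/-- A position is a finite multiset of components. -/
abbrev Position := Multiset Component

def Position.Valid (G : Position) : Prop := ∀ C ∈ G, C.Valid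

/-- The number of unclaimed boxes in a position. -/
def size (G : Position) : ℕ := (G.map Component.size).sum

/-- The number of chains of a position. -/
def numChains (G : Position) : ℕ := Multiset.card (G.filter fun C => C.isChain = true)

/-- The number of loops of a position. -/
def numLoops (G : Position) : ℕ := Multiset.card (G.filter fun C => C.isLoop = true)

/-- θ(G), the number of 3-chains. -/
def theta (G : Position) : ℕ := G.count (Component.chain 3)

/-- f(G), the number of 4-loops. -/
def numF (G : Position) : ℕ := G.count (Component.loop 4)

/-- s(G), the number of 6-loops. -/
def numS (G : Position) : ℕ := G.count (Component.loop 6)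

open Classical in
/-- The terminal bonus tb(G). -/
noncomputable def tb (G : Position) : ℤ :=
  if G = 0 then 0
  else if ∀ C ∈ G, C.isLoop = true then 8
  else if (∃ C ∈ G, C.isLoop = true) ∧ Component.chain 3 ∈ G ∧
      (∀ C ∈ G, C.isChain = true → C = Component.chain 3) then 6
  else 4

/-- The controlled value c(G). -/
noncomputable def cval (G : Position) : ℤ :=
  (size G : ℤ) - 4 * (numChains G : ℤ) - 8 * (numLoops G : ℤ) + tb G

/-- The score v(G;C) of opening component `C`, given that the remainder of the
position has value `w`. -/
def openVal (C : Component) (w : ℤ) : ℤ :=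
  match C with
  | Component.chain n => ((n : ℤ) - 2) + |w - 2|
  | Component.loop n => ((n : ℤ) - 4) + |w - 4|

/-- Auxiliary recursion (on the number of components) for the value `v`. -/
noncomputable def valueAux : ℕ → Position → ℤ
  | 0, _ => 0
  | n + 1, G =>
    if G = 0 then 0
    else sInf { x : ℤ | ∃ C ∈ G, x = openVal C (valueAux n (G.erase C)) }

/-- The value v(G): v(∅) = 0, and v(G) = min over components C of G of v(G;C). -/
noncomputable def value (G : Position) : ℤ := valueAux (Multiset.card G) G

/-- v(G;C), the value of G given that the opener has just opened C. -/
noncomputable def valueOpen (G : Position) (C : Component) : ℤ :=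
  openVal C (value (G.erase C))

/-- Opening a component C of G is optimal if C ∈ G and v(G;C) = v(G). -/
def Optimal (G : Position) (C : Component) : Prop :=
  C ∈ G ∧ valueOpen G C = value G


/-- A loop of length at least 8. -/
def Component.isBigLoop : Component → Bool
  | Component.loop n => 8 ≤ n
  | Component.chain _ => false

/-- A chain of length at least 4. -/
def Component.isLongChain : Component → Bool
  | Component.chain n => 4 ≤ n
  | Component.loop _ => false

open Classical in
/-- The core G₀ of G: all loops of length ≥ 8, together with all chains of length ≥ 4
if there are any, or with the 3-chains otherwise. -/
noncomputable def core (G : Position) : Position :=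
  if ∃ C ∈ G, C.isLongChain = true then
    G.filter fun C => C.isBigLoop = true ∨ C.isLongChain = true
  else
    G.filter fun C => C.isBigLoop = true ∨ C = Component.chain 3

/-- θ′(G), the number of 3-chains of G − G₀. -/
noncomputable def thetaPrime (G : Position) : ℕ := theta (G - core G)

/-- Σ(x) = |x − 4| + 2. -/
def SigOp (x : ℤ) : ℤ := |x - 4| + 2

/-- Θ(x) = x − 1. -/
def ThetaOp (x : ℤ) : ℤ := x - 1

/-- Φ(x) = |x − 4|. -/
def PhiOp (x : ℤ) : ℤ := |x - 4|


end DotsAndBoxes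

namespace DotsAndBoxes

/-- Distance-to-multiples-of-8 folding: closed form of iterating `PhiOp`. -/
def fold8 (z : ℤ) : ℤ := if 0 ≤ z then z else if z % 8 ≤ 4 then z % 8 else 8 - z % 8

/-- Closed form of iterating `SigOp`. -/
def sat (x s : ℤ) : ℤ :=
  if s = 0 ∨ 2 ≤ x - 2 * s then x - 2 * s
  else if x % 2 = 1 then 3 else if (x - 2 * s) % 4 = 2 then 2 else 4

/-- Terminal bonus in terms of parameters. -/
def tbv (th f s : ℤ) (L B : Bool) : ℤ :=
  if L = true then 4
  else if th = 0 then (if 0 < f ∨ 0 < s ∨ B = true then 8 else 0)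
  else (if 0 < f ∨ 0 < s ∨ B = true then 6 else 4)

/-- Controlled value in terms of parameters. -/
def cv (th f s : ℤ) (L B : Bool) (E : ℤ) : ℤ := E - th - 4 * f - 2 * s + tbv th f s L B

/-- The part of the procedural value not involving 4-loops. -/
def base (th s : ℤ) (L B : Bool) (E : ℤ) : ℤ :=
  if L = true then sat (E + 4) s - th
  else if th = 0 then
    (if B = true then sat (E + 8) s else if 0 < s then sat 8 s else 0)
  else if B = true then sat (E + 5) s
  else sat 3 s

/-- The hypothesis of part (3). -/
def Case3 (th s E : ℤ) : Prop := th = 0 ∨ (th = 1 ∧ (E - th - 2 * s) % 4 = 3)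

instance (th s E : ℤ) : Decidable (Case3 th s E) := by unfold Case3; infer_instance

/-- The predicted value. -/
def Fv (th f s : ℤ) (L B : Bool) (E : ℤ) : ℤ :=
  if Case3 th s E then fold8 (base th s L B E - 4 * f)
  else if 2 ≤ cv th f s L B E then cv th f s L B E
  else if cv th f s L B E = 0 ∧ 0 < f ∧ ¬ (f = 1 ∧ th = 2 ∧ s = 0 ∧ L = false ∧ B = false) then 0
  else if (E - th - 2 * s) % 2 = 1 then 1 else 2

/-- Consistency of parameters. -/
def Ok (th f s : ℤ) (L B : Bool) (E : ℤ) : Prop :=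
  0 ≤ th ∧ 0 ≤ f ∧ 0 ≤ s ∧ 0 ≤ E ∧ (L = false → E % 2 = 0) ∧ (L = false → B = false → E = 0)

theorem sat_spec (x s : ℤ) (hx : 2 ≤ x) (hs : 0 ≤ s) :
    (sat x s = x - 2 * s ∧ 2 ≤ x - 2 * s) ∨
    (x - 2 * s ≤ 1 ∧ 2 ≤ sat x s ∧ sat x s ≤ 4 ∧ sat x s % 2 = x % 2 ∧
      (x % 2 = 0 → sat x s % 4 = (x - 2 * s) % 4)) := by
  unfold sat
  split_ifs <;> omega

theorem fold8_spec (z : ℤ) : (0 ≤ z ∧ fold8 z = z) ∨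
    (z < 0 ∧ 0 ≤ fold8 z ∧ fold8 z ≤ 4 ∧ ((z - fold8 z) % 8 = 0 ∨ (z + fold8 z) % 8 = 0)) := by
  unfold fold8
  split_ifs <;> omega

theorem fold8_step (z : ℤ) : fold8 (z - 4) = |fold8 z - 4| := by
  rcases abs_cases (fold8 z - 4) with ⟨h, h'⟩ | ⟨h, h'⟩ <;> rw [h] <;> clear h <;>
    unfold fold8 at * <;> split_ifs at * <;> omega

theorem sat_step (x s : ℤ) (hx : 2 ≤ x) (hs : 0 ≤ s) : sat x (s + 1) = |sat x s - 4| + 2 := by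
  rcases abs_cases (sat x s - 4) with ⟨h, h'⟩ | ⟨h, h'⟩ <;> rw [h] <;> clear h <;>
    unfold sat at * <;> split_ifs at * <;> omega

/-- `base` versus the controlled value in case (3). -/
theorem base_spec {th f s : ℤ} {L B : Bool} {E : ℤ} (h : Ok th f s L B E) (h3 : Case3 th s E) :
    (base th s L B E = cv th f s L B E + 4 * f ∧ (base th s L B E = 0 ∨ 2 ≤ base th s L B E)
      ∧ (base th s L B E = 0 → th = 0 ∧ s = 0 ∧ L = false ∧ B = false)) ∨
    (cv th f s L B E + 4 * f ≤ 1 ∧ 2 ≤ base th s L B E ∧ base th s L B E ≤ 4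
      ∧ (th = 1 → base th s L B E = 3)
      ∧ base th s L B E % 2 = (E - th) % 2 ∧
      (th = 0 → E % 2 = 0 → base th s L B E % 4 = (E - 2 * s) % 4)) ∨
    (E = 0 ∧ th = 0 ∧ s = 0 ∧ 1 ≤ f ∧ base th s L B E = 0 ∧ cv th f s L B E + 4 * f = 8) ∨
    (E = 0 ∧ th = 1 ∧ s = 0 ∧ 1 ≤ f ∧ base th s L B E = 3 ∧ cv th f s L B E + 4 * f = 5) := by
  obtain ⟨h1, h2, h4, h5, h6, h7⟩ := h
  have ht : cv th f s L B E = E - th - 4 * f - 2 * s + tbv th f s L B := rfl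
  rw [ht]
  cases L
  · have hE : E % 2 = 0 := h6 rfl
    cases B
    · have hE0 : E = 0 := h7 rfl rfl
      subst hE0
      rcases h3 with h3 | ⟨h3, h8⟩
      · subst h3
        rcases h4.eq_or_lt with h9 | h9
        · subst h9
          have hb : base 0 0 false false 0 = 0 := by simp [base]
          rw [hb]
          rcases h2.eq_or_lt with h10 | h10
          · subst h10
            left
            simp [tbv]
          · right; right; left
            simp [tbv, h10]
            omega
        · have hb : base 0 s false false 0 = sat 8 s := by simp [base, h9]
          have htb : tbv 0 f s false false = 8 := by simp [tbv, h9]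
          rw [hb, htb]
          rcases sat_spec 8 s (by omega) h4 with ⟨a, b⟩ | ⟨a, b, c, d, e⟩
          · left
            refine ⟨by omega, by omega, by omega⟩
          · right; left
            refine ⟨by omega, by omega, by omega, by omega, by omega, by omega⟩
      · subst h3
        have hb : base 1 s false false 0 = sat 3 s := by simp [base]
        rw [hb]
        rcases h4.eq_or_lt with h9 | h9
        · subst h9
          rcases h2.eq_or_lt with h10 | h10
          · subst h10
            left
            simp [tbv, sat]
          · right; right; right
            simp [tbv, sat, h10]
            omega
        · have htb : tbv 1 f s false false = 6 := by simp [tbv, h9]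
          rw [htb]
          rcases sat_spec 3 s (by omega) h4 with ⟨a, b⟩ | ⟨a, b, c, d, e⟩
          · omega
          · have : 1 < s := by omega
            right; left
            refine ⟨by omega, by omega, by omega, by omega, by omega, by omega⟩
    · rcases h3 with h3 | ⟨h3, h8⟩
      · subst h3
        have hb : base 0 s false true E = sat (E + 8) s := by simp [base]
        have htb : tbv 0 f s false true = 8 := by simp [tbv]
        rw [hb, htb]
        rcases sat_spec (E + 8) s (by omega) h4 with ⟨a, b⟩ | ⟨a, b, c, d, e⟩
        · left
          refine ⟨by omega, by omega, by omega⟩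
        · right; left
          refine ⟨by omega, by omega, by omega, by omega, by omega, by omega⟩
      · subst h3
        have hb : base 1 s false true E = sat (E + 5) s := by simp [base]
        have htb : tbv 1 f s false true = 6 := by simp [tbv]
        rw [hb, htb]
        rcases sat_spec (E + 5) s (by omega) h4 with ⟨a, b⟩ | ⟨a, b, c, d, e⟩
        · left
          refine ⟨by omega, by omega, by omega⟩
        · right; left
          refine ⟨by omega, by omega, by omega, by omega, by omega, by omega⟩
  · have hb : base th s true B E = sat (E + 4) s - th := by simp [base]
    have htb : tbv th f s true B = 4 := by simp [tbv]
    rw [hb, htb]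
    rcases h3 with h3 | ⟨h3, h8⟩ <;> subst h3 <;>
    rcases sat_spec (E + 4) s (by omega) h4 with ⟨a, b⟩ | ⟨a, b, c, d, e⟩
    · left
      refine ⟨by omega, by omega, by omega⟩
    · right; left
      refine ⟨by omega, by omega, by omega, by omega, by omega, by omega⟩
    · left
      refine ⟨by omega, by omega, by omega⟩
    · right; left
      refine ⟨by omega, by omega, by omega, by omega, by omega, by omega⟩

theorem spec_case3 {th f s E c t y w : ℤ} (h2 : 0 ≤ f)
    (hc : c = E - th - 4 * f - 2 * s + t)
    (ht : t % 4 = 0 ∨ (th = 1 ∧ t = 6))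
    (h3 : th = 0 ∨ (th = 1 ∧ (E - th - 2 * s) % 4 = 3))
    (hb : (y = c + 4 * f ∧ (y = 0 ∨ 2 ≤ y)) ∨
      (c + 4 * f ≤ 1 ∧ 2 ≤ y ∧ y ≤ 4 ∧ (th = 1 → y = 3) ∧ y % 2 = (E - th) % 2 ∧
        (th = 0 → E % 2 = 0 → y % 4 = (E - 2 * s) % 4)) ∨
      (E = 0 ∧ th = 0 ∧ s = 0 ∧ 1 ≤ f ∧ y = 0 ∧ c + 4 * f = 8) ∨
      (E = 0 ∧ th = 1 ∧ s = 0 ∧ 1 ≤ f ∧ y = 3 ∧ c + 4 * f = 5))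
    (hf : (0 ≤ y - 4 * f ∧ w = y - 4 * f) ∨
      (y - 4 * f < 0 ∧ 0 ≤ w ∧ w ≤ 4 ∧ ((y - 4 * f - w) % 8 = 0 ∨ (y - 4 * f + w) % 8 = 0))) :
    c ≤ w ∧ 0 ≤ w ∧ w % 2 = (E - th) % 2 ∧ (2 ≤ c → w = c) ∧ (c ≤ 1 → w ≤ 4) ∧
    (th = 0 → E % 2 = 0 → w % 4 = (E - 2 * s) % 4) ∧
    (1 ≤ th → c ≤ 1 → w ≤ 3) ∧ (f = 0 → y ≠ 0 → 1 ≤ w) ∧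
    (th = 1 → f = 0 → c ≤ 1 → w = 3) ∧ (c = 0 → 0 < f → w = 0) := by
  have hm : w % 2 = (E - th) % 2 ∧ (th = 0 → E % 2 = 0 → w % 4 = (E - 2 * s) % 4) := by
    have hy : y % 2 = (E - th) % 2 ∧ (th = 0 → E % 2 = 0 → y % 4 = (E - 2 * s) % 4) := by
      rcases h3 with h3 | ⟨h3, h8⟩ <;> subst h3 <;> rcases hb with hb | hb | hb | hb
      all_goals omega
    clear hb ht hc
    rcases hf with hf | ⟨_, _, _, hf | hf⟩ <;> omega
  obtain ⟨m1, m2⟩ := hm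
  refine ⟨?_, ?_, m1, ?_, ?_, m2, ?_, ?_, ?_, ?_⟩ <;> clear m2
  · clear ht hc m1
    rcases hf with hf | ⟨_, _, _, hf⟩
    · rcases hb with hb | hb | hb | hb <;> omega
    · rcases hb with hb | hb | hb | hb <;> omega
  · omega
  · clear ht hc m1
    rcases hf with hf | ⟨_, _, _, hf⟩ <;> rcases hb with hb | hb | hb | hb <;> omega
  · clear ht hc m1
    rcases hf with hf | ⟨_, _, _, hf⟩ <;> rcases hb with hb | hb | hb | hb <;> omega
  · clear ht hc
    intro a b
    rcases hf with hf | ⟨_, _, _, hf⟩ <;> rcases hb with hb | hb | hb | hb <;> omega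
  · clear ht hc m1 h3
    rcases hf with hf | ⟨_, _, _, hf⟩ <;> rcases hb with hb | hb | hb | hb <;> omega
  · clear hc ht
    intro a b d
    rcases hf with hf | ⟨_, _, _, hf⟩ <;> rcases hb with hb | hb | hb | hb <;> omega
  · clear hc ht
    intro a b
    rcases hf with hf | ⟨_, _, _, hf⟩ <;> rcases hb with hb | hb | hb | hb <;> omega

/-- Everything we need to know about the predicted value. -/
theorem Fv_spec {th f s : ℤ} {L B : Bool} {E : ℤ} (h : Ok th f s L B E) :
    cv th f s L B E ≤ Fv th f s L B E ∧ 0 ≤ Fv th f s L B E ∧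
    Fv th f s L B E % 2 = (E - th) % 2 ∧
    (2 ≤ cv th f s L B E → Fv th f s L B E = cv th f s L B E) ∧
    (cv th f s L B E ≤ 1 → Fv th f s L B E ≤ 4) ∧
    (th = 0 → E % 2 = 0 → Fv th f s L B E % 4 = (E - 2 * s) % 4) ∧
    (1 ≤ th → cv th f s L B E ≤ 1 → Fv th f s L B E ≤ 3) ∧
    (f = 0 → (th ≠ 0 ∨ s ≠ 0 ∨ L = true ∨ B = true) → 1 ≤ Fv th f s L B E) ∧
    (th = 1 → f = 0 → (E - th - 2 * s) % 4 = 3 → cv th f s L B E ≤ 1 → Fv th f s L B E = 3) ∧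
    ((cv th f s L B E = 0 ∧ 0 < f ∧ ¬ (f = 1 ∧ th = 2 ∧ s = 0 ∧ L = false ∧ B = false)) →
      Fv th f s L B E = 0) ∧
    (cv th f s L B E ≤ 1 →
     ¬ (cv th f s L B E = 0 ∧ 0 < f ∧ ¬ (f = 1 ∧ th = 2 ∧ s = 0 ∧ L = false ∧ B = false)) →
      ¬ (th = 0 ∨ (th = 1 ∧ (E - th - 2 * s) % 4 = 3)) →
      1 ≤ Fv th f s L B E ∧ Fv th f s L B E ≤ 2) := by
  by_cases h3 : Case3 th s E
  · have hb := base_spec h h3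
    have hf := fold8_spec (base th s L B E - 4 * f)
    obtain ⟨h1, h2, h4, h5, h6, h7⟩ := h
    simp only [Fv, if_pos h3]
    have ht : cv th f s L B E = E - th - 4 * f - 2 * s + tbv th f s L B := rfl
    have ht2 : tbv th f s L B % 4 = 0 ∨ (th = 1 ∧ tbv th f s L B = 6) := by
      unfold Case3 at h3; unfold tbv; split_ifs <;> omega
    obtain ⟨r1, r2, r3, r4, r5, r6, r7, r8, r9, r10⟩ := spec_case3 h2 ht ht2 h3
      (by rcases hb with hb | hb | hb | hb
          · exact Or.inl ⟨hb.1, hb.2.1⟩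
          · exact Or.inr (Or.inl hb)
          · exact Or.inr (Or.inr (Or.inl hb))
          · exact Or.inr (Or.inr (Or.inr hb))) hf
    refine ⟨r1, r2, r3, r4, r5, r6, r7, ?_, fun a b _ => r9 a b, fun a => r10 a.1 a.2.1,
      fun _ _ a => absurd h3 a⟩
    intro e e2
    apply r8 e
    intro e3
    rcases hb with ⟨_, _, hb⟩ | hb | hb | hb
    · obtain ⟨k1, k2, k3, k4⟩ := hb e3
      simp [k1, k2, k3, k4] at e2
    all_goals omega
  · obtain ⟨h1, h2, h4, h5, h6, h7⟩ := h
    simp only [Fv, if_neg h3]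
    have ht : cv th f s L B E = E - th - 4 * f - 2 * s + tbv th f s L B := rfl
    have ht2 : tbv th f s L B = 4 ∨ tbv th f s L B = 6 := by
      unfold Case3 at h3; unfold tbv; split_ifs <;> omega
    unfold Case3 at h3
    generalize cv th f s L B E = c at *
    generalize tbv th f s L B = t at *
    split_ifs with g1 g2 g3
    · refine ⟨?_, ?_, ?_, ?_, ?_, ?_, ?_, ?_, ?_, ?_, ?_⟩ <;> omega
    · obtain ⟨g2, g4, g5⟩ := g2
      refine ⟨?_, ?_, ?_, ?_, ?_, ?_, ?_, ?_, ?_, ?_, ?_⟩ <;> first | omega | exact fun _ => rfl | exact fun _ a => absurd ⟨g2, g4, g5⟩ a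
    all_goals
      refine ⟨?_, ?_, ?_, ?_, ?_, ?_, ?_, ?_, ?_, ?_, ?_⟩ <;> first | omega | exact fun a => absurd a g2
end DotsAndBoxes

namespace DotsAndBoxes

theorem Fv_le_two {th f s : ℤ} {L B : Bool} {E : ℤ} (h : Ok th f s L B E)
    (hc : cv th f s L B E ≤ 1) (h3 : ¬ (th = 0 ∨ (th = 1 ∧ (E - th - 2 * s) % 4 = 3))) :
    Fv th f s L B E ≤ 2 := by
  obtain ⟨-, -, -, -, -, -, -, -, -, a, b⟩ := Fv_spec h
  by_cases h0 : cv th f s L B E = 0 ∧ 0 < f ∧ ¬ (f = 1 ∧ th = 2 ∧ s = 0 ∧ L = false ∧ B = false)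
  · have := a h0
    omega
  · exact (b hc h0 h3).2

theorem Fv_one_le {th f s : ℤ} {L B : Bool} {E : ℤ} (h : Ok th f s L B E)
    (hc : cv th f s L B E ≤ 1) (h3 : ¬ (th = 0 ∨ (th = 1 ∧ (E - th - 2 * s) % 4 = 3)))
    (h0 : cv th f s L B E ≠ 0 ∨ f = 0) :
    1 ≤ Fv th f s L B E := by
  obtain ⟨-, -, -, -, -, -, -, -, -, a, b⟩ := Fv_spec h
  exact (b hc (by rintro ⟨h1, h2, -⟩; omega) h3).1

theorem Fv_T_le {th f s : ℤ} {L B : Bool} {E : ℤ} (h : Ok th f s L B E) :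
    Fv (th + 1) f s L B E ≤ 1 + |Fv th f s L B E - 2| := by
  have h' : Ok (th + 1) f s L B E := by
    obtain ⟨h1, h2⟩ := h; exact ⟨by omega, h2⟩
  have ha := abs_cases (Fv th f s L B E - 2)
  have l2 := Fv_le_two h'
  obtain ⟨p1, p2, p3, p4, p5, p6, p7, -⟩ := Fv_spec h
  obtain ⟨q1, q2, q3, q4, q5, q6, q7, -⟩ := Fv_spec h'
  obtain ⟨h1, h2, h4, h5, h6, h7⟩ := h
  have ht : cv th f s L B E = E - th - 4 * f - 2 * s + tbv th f s L B := rfl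
  have ht' : cv (th + 1) f s L B E = E - (th + 1) - 4 * f - 2 * s + tbv (th + 1) f s L B := rfl
  have htb : tbv (th + 1) f s L B = tbv th f s L B ∨
      (th = 0 ∧ tbv (th + 1) f s L B = 6 ∧ tbv th f s L B = 8) ∨
      (th = 0 ∧ f = 0 ∧ s = 0 ∧ E = 0 ∧ tbv (th + 1) f s L B = 4 ∧ tbv th f s L B = 0) := by
    cases L <;> cases B <;> simp [tbv] at * <;> split_ifs <;> omega
  generalize Fv th f s L B E = w at *
  generalize Fv (th + 1) f s L B E = w' at *
  generalize tbv (th + 1) f s L B = t' at *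
  generalize tbv th f s L B = t at *
  generalize cv th f s L B E = c at *
  generalize cv (th + 1) f s L B E = c' at *
  clear h6 h7
  by_cases hc : 2 ≤ c'
  · clear p3 p5 p7 q3 q5 q6 q7 l2
    rcases htb with htb | htb | htb
    · clear p6
      omega
    · clear p6
      omega
    · have := p6 (by omega) (by omega)
      omega
  · have hw := q7 (by omega) (by omega)
    by_cases hw3 : w' = 3
    · have hcase : th = 0 ∧ (E - 1 - 2 * s) % 4 = 3 := by
        by_contra hcon
        have := l2 (by omega) (by omega)
        omega
      obtain ⟨rfl, hcase⟩ := hcase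
      have := p6 rfl (by omega)
      clear p1 p2 p3 p4 p5 p6 p7 q1 q2 q3 q4 q5 q6 q7 l2 htb ht ht'
      omega
    · clear p5 p6 p7 q5 q6 q7 l2 p4 q4 htb ht ht'
      omega

theorem Fv_F_eq {th f s : ℤ} {L B : Bool} {E : ℤ}
    (h3 : th = 0 ∨ (th = 1 ∧ (E - th - 2 * s) % 4 = 3)) :
    Fv th (f + 1) s L B E = |Fv th f s L B E - 4| := by
  have h3' : Case3 th s E := h3
  simp only [Fv, if_pos h3']
  rw [← fold8_step]
  congr 1
  ring

theorem Fv_F_le {th f s : ℤ} {L B : Bool} {E : ℤ} (h : Ok th f s L B E) :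
    Fv th (f + 1) s L B E ≤ |Fv th f s L B E - 4| := by
  by_cases h3 : th = 0 ∨ (th = 1 ∧ (E - th - 2 * s) % 4 = 3)
  · exact (Fv_F_eq h3).le
  have h' : Ok th (f + 1) s L B E := by
    obtain ⟨h1, h2, h4⟩ := h; exact ⟨h1, by omega, h4⟩
  have ha := abs_cases (Fv th f s L B E - 4)
  have l2 := fun k => Fv_le_two h' k h3
  have m2 := fun k => Fv_le_two h k h3
  obtain ⟨p1, p2, p3, p4, p5, p6, p7, -⟩ := Fv_spec h
  obtain ⟨q1, q2, q3, q4, q5, q6, q7, -, -, q10, -⟩ := Fv_spec h'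
  obtain ⟨h1, h2, h4, h5, h6, h7⟩ := h
  have ht : cv th f s L B E = E - th - 4 * f - 2 * s + tbv th f s L B := rfl
  have ht' : cv th (f + 1) s L B E = E - th - 4 * (f + 1) - 2 * s + tbv th (f + 1) s L B := rfl
  have htb : (tbv th (f + 1) s L B = tbv th f s L B ∧
      ¬ (f = 0 ∧ s = 0 ∧ L = false ∧ B = false)) ∨
      (f = 0 ∧ s = 0 ∧ E = 0 ∧ tbv th (f + 1) s L B = 6 ∧ tbv th f s L B = 4) := by
    cases L <;> cases B <;> simp [tbv] at * <;> split_ifs <;> omega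
  have q10' : ¬ (f = 0 ∧ s = 0 ∧ L = false ∧ B = false) → cv th (f + 1) s L B E = 0 →
      Fv th (f + 1) s L B E = 0 := by
    intro a b
    refine q10 ⟨b, by omega, ?_⟩
    rintro ⟨a1, a2, a3, a4, a5⟩
    exact a ⟨by omega, a3, a4, a5⟩
  clear q10
  generalize Fv th f s L B E = w at *
  generalize Fv th (f + 1) s L B E = w' at *
  generalize tbv th (f + 1) s L B = t' at *
  generalize tbv th f s L B = t at *
  generalize cv th f s L B E = c at *
  generalize cv th (f + 1) s L B E = c' at *
  clear h6 h7 p6 q6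
  by_cases hc : 2 ≤ c'
  · clear p3 p5 p7 q3 q5 q7 l2 m2 q10'
    rcases htb with ⟨htb, -⟩ | htb <;> omega
  · have hw := l2 (by omega)
    clear l2 p5 p7 q5 q7
    rcases htb with ⟨htb, hx⟩ | htb
    · have := q10' hx
      clear q10' hx
      by_cases hc2 : 2 ≤ c
      · omega
      · have := m2 (by omega)
        omega
    · clear q10'
      by_cases hc2 : 2 ≤ c
      · omega
      · have := m2 (by omega)
        omega

theorem Fv_S_le {th f s : ℤ} {L B : Bool} {E : ℤ} (h : Ok th f s L B E) :
    Fv th f (s + 1) L B E ≤ 2 + |Fv th f s L B E - 4| := by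
  have h' : Ok th f (s + 1) L B E := by
    obtain ⟨h1, h2, h3, h4⟩ := h; exact ⟨h1, h2, by omega, h4⟩
  have ha := abs_cases (Fv th f s L B E - 4)
  obtain ⟨p1, p2, p3, p4, p5, p6, p7, -⟩ := Fv_spec h
  obtain ⟨q1, q2, q3, q4, q5, q6, q7, -⟩ := Fv_spec h'
  obtain ⟨h1, h2, h4, h5, h6, h7⟩ := h
  have ht : cv th f s L B E = E - th - 4 * f - 2 * s + tbv th f s L B := rfl
  have ht' : cv th f (s + 1) L B E = E - th - 4 * f - 2 * (s + 1) + tbv th f (s + 1) L B := rfl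
  have htb : (tbv th f (s + 1) L B = tbv th f s L B) ∨
      (f = 0 ∧ s = 0 ∧ E = 0 ∧ 1 ≤ th ∧ tbv th f (s + 1) L B = 6 ∧ tbv th f s L B = 4) ∨
      (f = 0 ∧ s = 0 ∧ E = 0 ∧ th = 0 ∧ Fv th f s L B E = 0 ∧ 
        tbv th f (s + 1) L B = 8 ∧ tbv th f s L B = 0) := by
    by_cases hz : f = 0 ∧ s = 0 ∧ E = 0 ∧ th = 0 ∧ L = false ∧ B = false
    · obtain ⟨rfl, rfl, rfl, rfl, rfl, rfl⟩ := hz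
      simp [tbv, Fv, Case3, base, fold8]
    · clear p1 p2 p3 p4 p5 p6 p7 q1 q2 q3 q4 q5 q6 q7 ha ht ht'
      cases L <;> cases B <;> simp [tbv] at * <;> split_ifs <;> omega
  generalize Fv th f s L B E = w at *
  generalize Fv th f (s + 1) L B E = w' at *
  generalize tbv th f (s + 1) L B = t' at *
  generalize tbv th f s L B = t at *
  generalize cv th f s L B E = c at *
  generalize cv th f (s + 1) L B E = c' at *
  clear h6 h7
  by_cases hc : 2 ≤ c'
  · clear p5 p6 p7 q5 q6 q7
    rcases htb with htb | htb | htb <;> omega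
  · have := q5 (by omega)
    clear htb ht ht' p1 p4 p5 p7 q1 q4 q5
    by_cases w' = 4
    · rcases h1.eq_or_lt with h1 | h1 <;> omega
    · omega

theorem Fv_L_le {th f s : ℤ} {L B : Bool} {E n : ℤ} (h : Ok th f s L B E) (hn : 4 ≤ n) :
    Fv th f s true B (E + (n - 4)) ≤ (n - 2) + |Fv th f s L B E - 2| := by
  have h' : Ok th f s true B (E + (n - 4)) := by
    obtain ⟨h1, h2, h3, h4, h5⟩ := h; exact ⟨h1, h2, h3, by omega, by simp, by simp⟩
  have ha := abs_cases (Fv th f s L B E - 2)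
  obtain ⟨p1, p2, p3, p4, p5, p6, p7, -⟩ := Fv_spec h
  obtain ⟨q1, q2, q3, q4, q5, q6, q7, -⟩ := Fv_spec h'
  obtain ⟨h1, h2, h4, h5, h6, h7⟩ := h
  have ht : cv th f s L B E = E - th - 4 * f - 2 * s + tbv th f s L B := rfl
  have ht' : cv th f s true B (E + (n - 4)) = E + (n - 4) - th - 4 * f - 2 * s + 4 := rfl
  have htb : 4 ≤ tbv th f s L B ∨
      (f = 0 ∧ s = 0 ∧ E = 0 ∧ th = 0 ∧ Fv th f s L B E = 0) := by
    by_cases hz : f = 0 ∧ s = 0 ∧ E = 0 ∧ th = 0 ∧ L = false ∧ B = false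
    · obtain ⟨rfl, rfl, rfl, rfl, rfl, rfl⟩ := hz
      simp [tbv, Fv, Case3, base, fold8]
    · clear p1 p2 p3 p4 p5 p6 p7 q1 q2 q3 q4 q5 q6 q7 ha ht ht'
      cases L <;> cases B <;> simp [tbv] at * <;> split_ifs <;> omega
  generalize Fv th f s L B E = w at *
  generalize Fv th f s true B (E + (n - 4)) = w' at *
  generalize tbv th f s L B = t at *
  generalize cv th f s L B E = c at *
  generalize cv th f s true B (E + (n - 4)) = c' at *
  clear h6 h7
  by_cases hc : 2 ≤ c'
  · clear p5 p6 p7 q5 q6 q7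
    rcases htb with htb | htb <;> omega
  · have := q5 (by omega)
    clear htb ht ht' p1 p4 p5 p7 q1 q4 q5
    by_cases w' = 4
    · rcases h1.eq_or_lt with h1 | h1 <;> omega
    · omega

theorem Fv_B_le {th f s : ℤ} {L B : Bool} {E n : ℤ} (h : Ok th f s L B E) (hn : 8 ≤ n)
    (hn2 : n % 2 = 0) :
    Fv th f s L true (E + (n - 8)) ≤ (n - 4) + |Fv th f s L B E - 4| := by
  have h' : Ok th f s L true (E + (n - 8)) := by
    obtain ⟨h1, h2, h3, h4, h5, h6⟩ := h
    exact ⟨h1, h2, h3, by omega, fun k => by have := h5 k; omega, by simp⟩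
  have ha := abs_cases (Fv th f s L B E - 4)
  obtain ⟨p1, p2, p3, p4, p5, p6, p7, -⟩ := Fv_spec h
  obtain ⟨q1, q2, q3, q4, q5, q6, q7, -⟩ := Fv_spec h'
  obtain ⟨h1, h2, h4, h5, h6, h7⟩ := h
  have ht : cv th f s L B E = E - th - 4 * f - 2 * s + tbv th f s L B := rfl
  have ht' : cv th f s L true (E + (n - 8)) =
    E + (n - 8) - th - 4 * f - 2 * s + tbv th f s L true := rfl
  have htb : (tbv th f s L true = tbv th f s L B) ∨
      (f = 0 ∧ s = 0 ∧ E = 0 ∧ 1 ≤ th ∧ tbv th f s L true = 6 ∧ tbv th f s L B = 4) ∨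
      (f = 0 ∧ s = 0 ∧ E = 0 ∧ th = 0 ∧ Fv th f s L B E = 0 ∧ 
        tbv th f s L true = 8 ∧ tbv th f s L B = 0) := by
    by_cases hz : f = 0 ∧ s = 0 ∧ E = 0 ∧ th = 0 ∧ L = false ∧ B = false
    · obtain ⟨rfl, rfl, rfl, rfl, rfl, rfl⟩ := hz
      simp [tbv, Fv, Case3, base, fold8]
    · clear p1 p2 p3 p4 p5 p6 p7 q1 q2 q3 q4 q5 q6 q7 ha ht ht'
      cases L <;> cases B <;> simp [tbv] at * <;> split_ifs <;> omega
  generalize Fv th f s L B E = w at *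
  generalize Fv th f s L true (E + (n - 8)) = w' at *
  generalize tbv th f s L true = t' at *
  generalize tbv th f s L B = t at *
  generalize cv th f s L B E = c at *
  generalize cv th f s L true (E + (n - 8)) = c' at *
  clear h6 h7
  by_cases hc : 2 ≤ c'
  · clear p5 p6 p7 q5 q6 q7
    rcases htb with htb | htb | htb <;> omega
  · have := q5 (by omega)
    have := abs_nonneg (w - 4)
    omega
end DotsAndBoxes

namespace DotsAndBoxes

theorem Fv_zero' {th f s : ℤ} {L B : Bool} {E : ℤ} (h : Ok th f s L B E)
    (hc : cv th f s L B E = 0) (hf : 0 < f)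
    (hx : ¬ (f = 1 ∧ th = 2 ∧ s = 0 ∧ L = false ∧ B = false)) : Fv th f s L B E = 0 := by
  obtain ⟨-, -, -, -, -, -, -, -, -, a, b⟩ := Fv_spec h
  exact a ⟨hc, hf, hx⟩

theorem opt_S {s : ℤ} {L B : Bool} {E : ℤ} (h : Ok 0 0 s L B E) :
    2 + |Fv 0 0 s L B E - 4| = Fv 0 0 (s + 1) L B E := by
  have h3 : Case3 0 s E := Or.inl rfl
  have h3' : Case3 0 (s + 1) E := Or.inl rfl
  obtain ⟨h1, h2, h4, h5, h6, h7⟩ := h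
  simp only [Fv, if_pos h3, if_pos h3', mul_zero, sub_zero]
  have key : ∀ x : ℤ, 2 ≤ x →
      2 + |fold8 (sat x s) - 4| = fold8 (sat x (s + 1)) := by
    intro x hx
    have e1 : fold8 (sat x s) = sat x s := by
      have := sat_spec x s hx h4
      unfold fold8; rw [if_pos (by omega)]
    have e2 : fold8 (sat x (s + 1)) = sat x (s + 1) := by
      have := sat_spec x (s + 1) hx (by omega)
      unfold fold8; rw [if_pos (by omega)]
    rw [e1, e2, sat_step x s hx h4, add_comm]
  cases L <;> cases B
  · rcases h4.eq_or_lt with h8 | h8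
    · subst h8
      simp [base, fold8, sat]
    · have : 0 < s + 1 := by omega
      simpa [base, h8, this] using key 8 (by omega)
  · simpa [base] using key (E + 8) (by omega)
  · simpa [base] using key (E + 4) (by omega)
  · simpa [base] using key (E + 4) (by omega)

theorem opt_L {L : Bool} {E n : ℤ} (h : Ok 0 0 0 L false E) (hn : 4 ≤ n) :
    (n - 2) + |Fv 0 0 0 L false E - 2| = Fv 0 0 0 true false (E + (n - 4)) := by
  obtain ⟨h1, h2, h4, h5, h6, h7⟩ := h
  cases L
  · have := h7 rfl rfl
    subst this
    simp [Fv, Case3, base, fold8, sat]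
    intro hneg
    omega
  · have e1 : 0 ≤ E + 4 := by omega
    have e2 : 0 ≤ E + (n - 4) + 4 := by omega
    simp [Fv, Case3, base, fold8, sat, e1, e2]
    rw [abs_of_nonneg (by omega)]
    omega

theorem opt_B0 {L B : Bool} {E n : ℤ} (h : Ok 0 0 0 L B E) (hn : 8 ≤ n) :
    (n - 4) + |Fv 0 0 0 L B E - 4| = Fv 0 0 0 L true (E + (n - 8)) := by
  obtain ⟨h1, h2, h4, h5, h6, h7⟩ := h
  have e1 : 0 ≤ E + 4 := by omega
  have e2 : 0 ≤ E + 8 := by omega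
  have e3 : 0 ≤ E + (n - 8) + 8 := by omega
  have e4 : 0 ≤ E + (n - 8) + 4 := by omega
  have e5 : 0 ≤ E + 8 - 4 := by omega
  cases L <;> cases B
  · have := h7 rfl rfl
    subst this
    simp [Fv, Case3, base, fold8, sat]
    intro hneg
    omega
  all_goals
    simp [Fv, Case3, base, fold8, sat, e1, e2, e3, e4]
    rw [abs_of_nonneg (by omega)]
    omega

theorem opt_B1 {B : Bool} {E n : ℤ} (h : Ok 1 0 0 false B E) (hn : 8 ≤ n) (hn2 : n % 2 = 0) :
    (n - 4) + |Fv 1 0 0 false B E - 4| = Fv 1 0 0 false true (E + (n - 8)) := by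
  have h' : Ok 1 0 0 false true (E + (n - 8)) := by
    obtain ⟨h1, h2, h3, h4, h5, h6⟩ := h
    exact ⟨h1, h2, h3, by omega, fun k => by have := h5 k; omega, by simp⟩
  obtain ⟨p1, p2, p3, p4, p5, p6, p7, -⟩ := Fv_spec h
  obtain ⟨q1, q2, q3, q4, q5, q6, q7, -⟩ := Fv_spec h'
  obtain ⟨h1, h2, h4, h5, h6, h7⟩ := h
  have := h6 rfl
  cases B
  · have := h7 rfl rfl
    subst this
    simp [cv, tbv] at *
    rw [p4, q4 (by omega)]
    norm_num
    omega
  · simp [cv, tbv] at *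
    rw [p4 (by omega), q4 (by omega), abs_of_nonneg (by omega)]
    omega

theorem opt_T {th s : ℤ} {L B : Bool} {E : ℤ} (h : Ok th 0 s L B E)
    (hx : 1 ≤ th ∨ L = true ∨ (s = 0 ∧ B = false)) :
    1 + |Fv th 0 s L B E - 2| = Fv (th + 1) 0 s L B E := by
  have h' : Ok (th + 1) 0 s L B E := by
    obtain ⟨h1, h2⟩ := h; exact ⟨by omega, h2⟩
  by_cases hz : th = 0 ∧ L = false
  · obtain ⟨rfl, rfl⟩ := hz
    have : s = 0 ∧ B = false := by simpa using hx
    obtain ⟨rfl, rfl⟩ := this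
    have : E = 0 := by
      obtain ⟨h1, h2, h4, h5, h6, h7⟩ := h
      exact h7 rfl rfl
    subst this
    simp [Fv, Case3, base, fold8, sat]
  have ha := abs_cases (Fv th 0 s L B E - 2)
  have l1 := Fv_one_le h'
  have l2 := Fv_le_two h'
  obtain ⟨p1, p2, p3, p4, p5, p6, p7, p8, -⟩ := Fv_spec h
  obtain ⟨q1, q2, q3, q4, q5, q6, q7, -, q9, -⟩ := Fv_spec h'
  obtain ⟨h1, h2, h4, h5, h6, h7⟩ := h
  have ht : cv th 0 s L B E = E - th - 4 * 0 - 2 * s + tbv th 0 s L B := rfl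
  have ht' : cv (th + 1) 0 s L B E = E - (th + 1) - 4 * 0 - 2 * s + tbv (th + 1) 0 s L B := rfl
  have htb : tbv (th + 1) 0 s L B = tbv th 0 s L B := by
    clear p1 p2 p3 p4 p5 p6 p7 p8 q1 q2 q3 q4 q5 q6 q7 q9 ha l1 l2 ht ht'
    cases L <;> cases B <;> simp [tbv] at * <;> split_ifs <;> omega
  have hp8 : 1 ≤ Fv th 0 s L B E := by
    apply p8 rfl
    by_cases hth : th = 0
    · right; right; left
      cases L
      · exact absurd ⟨hth, rfl⟩ hz
      · rfl
    · left; assumption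
  clear hx hz
  clear h6 h7 p8
  generalize Fv th 0 s L B E = w at *
  generalize Fv (th + 1) 0 s L B E = w' at *
  generalize tbv (th + 1) 0 s L B = t' at *
  generalize tbv th 0 s L B = t at *
  generalize cv th 0 s L B E = c at *
  generalize cv (th + 1) 0 s L B E = c' at *
  by_cases hc : 2 ≤ c'
  · clear p3 p5 p6 p7 q3 q5 q6 q7 q9 l1 l2
    omega
  · by_cases h3 : th + 1 = 0 ∨ (th + 1 = 1 ∧ (E - (th + 1) - 2 * s) % 4 = 3)
    · have e0 : th = 0 := by omega
      subst e0
      have := q9 rfl rfl (by omega) (by omega)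
      have := p6 rfl (by omega)
      clear p3 p6 p7 q3 q5 q6 q7 q9 l1 l2
      omega
    · have := l1 (by omega) h3 (Or.inr rfl)
      have := l2 (by omega) h3
      clear l1 l2 q9 q4 q5 q6 q7 q1
      have hw4 : w ≤ 3 := by
        rcases h1.eq_or_lt with h1 | h1
        · omega
        · omega
      clear p6 p4 p5 p7
      omega

theorem opt_TS {s : ℤ} {B : Bool} {E : ℤ} (h : Ok 0 0 s false B E) :
    1 + |Fv 0 0 (s + 1) false B E - 2| = Fv 1 0 (s + 1) false B E ∨
    2 + |Fv 1 0 s false B E - 4| = Fv 1 0 (s + 1) false B E := by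
  have hT : Ok 0 0 (s + 1) false B E := by
    obtain ⟨h1, h2, h3, h4⟩ := h; exact ⟨by omega, h2, by omega, h4⟩
  have hS : Ok 1 0 s false B E := by
    obtain ⟨h1, h2⟩ := h; exact ⟨by omega, h2⟩
  have hG : Ok 1 0 (s + 1) false B E := by
    obtain ⟨h1, h2, h3, h4⟩ := h; exact ⟨by omega, h2, by omega, h4⟩
  have ha := abs_cases (Fv 0 0 (s + 1) false B E - 2)
  have hb := abs_cases (Fv 1 0 s false B E - 4)
  have l1 := Fv_one_le hG
  have l2 := Fv_le_two hG
  obtain ⟨p1, p2, p3, p4, p5, p6, p7, p8, -⟩ := Fv_spec hT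
  obtain ⟨r1, r2, r3, r4, -⟩ := Fv_spec hS
  obtain ⟨q1, q2, q3, q4, q5, q6, q7, -, q9, -⟩ := Fv_spec hG
  obtain ⟨h1, h2, h4, h5, h6, h7⟩ := h
  have hp8 := p8 rfl (by right; left; omega)
  have hE := h6 rfl
  have hs1 : 0 < s + 1 := by omega
  have t1 : cv 0 0 (s + 1) false B E = E - 0 - 4 * 0 - 2 * (s + 1) + 8 := by simp [cv, tbv, hs1]
  have t2 : cv 1 0 (s + 1) false B E = E - 1 - 4 * 0 - 2 * (s + 1) + 6 := by simp [cv, tbv, hs1]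
  have t3 : cv 1 0 s false B E = E - 1 - 4 * 0 - 2 * s + 6 ∨
      (s = 0 ∧ E = 0 ∧ cv 1 0 s false B E = 3) := by
    cases B
    · have := h7 rfl rfl
      subst this
      rcases h4.eq_or_lt with h8 | h8
      · subst h8; right; simp [cv, tbv]
      · left; simp [cv, tbv, h8]
    · left; simp [cv, tbv]
  clear h7 p8 h6
  generalize Fv 0 0 (s + 1) false B E = w1 at *
  generalize Fv 1 0 s false B E = w2 at *
  generalize Fv 1 0 (s + 1) false B E = w at *
  generalize cv 0 0 (s + 1) false B E = c1 at *
  generalize cv 1 0 s false B E = c2 at *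
  generalize cv 1 0 (s + 1) false B E = c at *
  by_cases hc : 2 ≤ c
  · right
    clear p3 p5 p6 p7 q3 q5 q6 q7 q9 l1 l2 ha
    omega
  · left
    have hw1 := p6 rfl hE
    clear hb r1 r2 r3 r4 t3
    by_cases h3 : (1:ℤ) = 0 ∨ ((1:ℤ) = 1 ∧ (E - 1 - 2 * (s + 1)) % 4 = 3)
    · have := q9 rfl rfl (by omega) (by omega)
      clear p3 p6 p7 q3 q5 q6 q7 q9 l1 l2
      omega
    · have := l1 (by omega) h3 (Or.inr rfl)
      have := l2 (by omega) h3
      clear l1 l2 q9 q4 q5 q6 q7 q1 p6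
      have hw4 : w1 ≤ 4 := by omega
      have hw2 : w1 = 2 := by omega
      have hw0 : w = 1 := by omega
      clear p1 p2 p3 p4 p5 p7
      omega

theorem Fv_exc {th : ℤ} (h : 2 ≤ th) :
    Fv th (0 + 1) 0 false false 0 = if th % 2 = 1 then 1 else 2 := by
  have h3 : ¬ Case3 th 0 0 := by unfold Case3; omega
  have hc : cv th (0 + 1) 0 false false 0 = 2 - th := by
    have : th ≠ 0 := by omega
    simp [cv, tbv, this]
    ring
  unfold Fv
  rw [if_neg h3, hc, if_neg (by omega), if_neg]
  · have : (0 - th - 2 * 0) % 2 = th % 2 := by omega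
    rw [this]
  · rintro ⟨a, b, c⟩
    exact c ⟨by omega, by omega, rfl, rfl, rfl⟩

theorem opt_exc {th : ℤ} (h : 2 ≤ th) :
    1 + |Fv th (0 + 1) 0 false false 0 - 2| = Fv (th + 1) (0 + 1) 0 false false 0 := by
  rw [Fv_exc h, Fv_exc (by omega)]
  rcases (show th % 2 = 0 ∨ th % 2 = 1 by omega) with a | a
  · have b : (th + 1) % 2 = 1 := by omega
    simp [a, b]
  · have b : (th + 1) % 2 = 0 := by omega
    simp [a, b]

theorem tbv_TF {th f s : ℤ} {L B : Bool} {E : ℤ} (h1 : 0 ≤ th) (h2 : 0 ≤ f) (h4 : 0 ≤ s)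
    (h6 : L = false → E % 2 = 0) (hx : ¬ (f = 0 ∧ s = 0 ∧ L = false ∧ B = false)) :
    tbv (th + 1) (f + 1) s L B % 2 = 0 ∧
    tbv (th + 1) f s L B = tbv (th + 1) (f + 1) s L B ∧
    (tbv th (f + 1) s L B = tbv (th + 1) (f + 1) s L B ∨
        (th = 0 ∧ E % 2 = 0 ∧ tbv th (f + 1) s L B = 8 ∧ tbv (th + 1) (f + 1) s L B = 6)) := by
  have e1 : 0 < f + 1 := by omega
  have e2 : th + 1 ≠ 0 := by omega
  cases L <;> cases B <;> simp [tbv, e1, e2] at *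
  · refine ⟨by omega, ?_⟩
    by_cases e : th = 0 <;> simp [e]
    omega
  · by_cases e : th = 0 <;> simp [e]
    omega

theorem opt_TF {th f s : ℤ} {L B : Bool} {E : ℤ} (h : Ok th f s L B E) :
    1 + |Fv th (f + 1) s L B E - 2| = Fv (th + 1) (f + 1) s L B E ∨
    |Fv (th + 1) f s L B E - 4| = Fv (th + 1) (f + 1) s L B E := by
  by_cases h3 : th + 1 = 0 ∨ (th + 1 = 1 ∧ (E - (th + 1) - 2 * s) % 4 = 3)
  · exact Or.inr (Fv_F_eq h3).symm
  by_cases hx : f = 0 ∧ s = 0 ∧ L = false ∧ B = false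
  · -- one 4-loop and several 3-chains
    obtain ⟨rfl, rfl, rfl, rfl⟩ := hx
    obtain ⟨h1, h2, h4, h5, h6, h7⟩ := h
    have := h7 rfl rfl
    subst this
    left
    rcases (show th = 1 ∨ 2 ≤ th by omega) with h8 | h8
    · subst h8
      simp [Fv, Case3, cv, tbv, base, fold8, sat]
    · exact opt_exc h8
  have hT : Ok th (f + 1) s L B E := by
    obtain ⟨h1, h2, h4⟩ := h; exact ⟨h1, by omega, h4⟩
  have hF : Ok (th + 1) f s L B E := by
    obtain ⟨h1, h2⟩ := h; exact ⟨by omega, h2⟩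
  have hG : Ok (th + 1) (f + 1) s L B E := by
    obtain ⟨h1, h2, h4⟩ := h; exact ⟨by omega, by omega, h4⟩
  obtain ⟨h1, h2, h4, h5, h6, h7⟩ := h
  have t1 : cv th (f + 1) s L B E = E - th - 4 * (f + 1) - 2 * s + tbv th (f + 1) s L B := rfl
  have t2 : cv (th + 1) f s L B E = E - (th + 1) - 4 * f - 2 * s + tbv (th + 1) f s L B := rfl
  have t3 : cv (th + 1) (f + 1) s L B E =
    E - (th + 1) - 4 * (f + 1) - 2 * s + tbv (th + 1) (f + 1) s L B := rfl
  obtain ⟨u0, u1, u2⟩ := tbv_TF (th := th) h1 h2 h4 h6 hx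
  have hcF : cv (th + 1) f s L B E = cv (th + 1) (f + 1) s L B E + 4 := by
    rw [t2, t3, u1]; ring
  have hcT : cv th (f + 1) s L B E = cv (th + 1) (f + 1) s L B E + 1 ∨
      (th = 0 ∧ E % 2 = 0 ∧ cv th (f + 1) s L B E = cv (th + 1) (f + 1) s L B E + 3) := by
    clear hT hF hG h6 h7 hx
    omega
  have hpar : cv (th + 1) (f + 1) s L B E % 2 = (E - (th + 1)) % 2 := by
    clear hT hF hG h6 h7 hx u1 u2 t1 t2 hcF hcT
    omega
  clear t1 t2 t3 u0 u1 u2 h6 h7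
  have l1 := fun k => Fv_one_le hG k h3
  have l2 := fun k => Fv_le_two hG k h3
  by_cases hc : -1 ≤ cv (th + 1) (f + 1) s L B E
  · right
    clear hcT
    obtain ⟨-, -, -, r4, -⟩ := Fv_spec hF
    obtain ⟨-, -, q3, q4, -⟩ := Fv_spec hG
    rw [r4 (by rw [hcF]; linarith), hcF]
    clear r4
    by_cases hc2 : 2 ≤ cv (th + 1) (f + 1) s L B E
    · rw [q4 hc2, abs_of_nonneg (by linarith)]
      ring
    · have k2 := l2 (by linarith)
      by_cases hc0 : cv (th + 1) (f + 1) s L B E = 0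
      · rw [Fv_zero' hG hc0 (by linarith) (by
          rintro ⟨a1, a2, a3, a4, a5⟩
          exact hx ⟨by linarith, a3, a4, a5⟩), hc0]
        norm_num
      · have k1 := l1 (by linarith) (Or.inl hc0)
        clear l1 l2 q4
        generalize Fv (th + 1) (f + 1) s L B E = w at *
        generalize cv (th + 1) (f + 1) s L B E = c at *
        clear h3 hF hG hT hx hcF
        have hw : w = 1 := by omega
        rcases (show c = 1 ∨ c = -1 by omega) with e | e
        · rw [hw, e]; norm_num
        · rw [hw, e]; norm_num
  · left
    have k2 := l2 (by linarith)
    have k1 := l1 (by linarith) (by left; intro hh; apply hc; rw [hh]; norm_num)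
    have hc1 : cv th (f + 1) s L B E ≤ 1 := by
      clear l1 l2 h3
      omega
    have hne : cv th (f + 1) s L B E ≠ 0 ∨ (th = 0 ∧ E % 2 = 0) := by
      clear l1 l2 h3
      omega
    obtain ⟨-, -, q3, -⟩ := Fv_spec hG
    obtain ⟨-, p2, p3, -, p5, p6, p7, -⟩ := Fv_spec hT
    have m1 := Fv_one_le hT hc1
    have p5 := p5 hc1
    clear l1 l2 hcF hcT hpar
    have hw : 1 ≤ Fv th (f + 1) s L B E ∧ Fv th (f + 1) s L B E ≤ 3 := by
      rcases h1.eq_or_lt with h1 | h1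
      · subst h1
        clear p7 m1 hne
        rcases (show E % 2 = 0 ∨ E % 2 = 1 by omega) with he | he
        · have := p6 rfl he
          clear p6
          omega
        · clear p6
          omega
      · refine ⟨?_, p7 (by omega) hc1⟩
        clear p6 p7
        by_cases hcs : th = 1 ∧ (E - 1 - 2 * s) % 4 = 3
        · obtain ⟨rfl, hcs⟩ := hcs
          clear m1
          omega
        · refine m1 ?_ (Or.inl ?_)
          · rintro (a | ⟨rfl, a⟩)
            · omega
            · exact hcs ⟨rfl, a⟩
          · rcases hne with a | a
            · exact a
            · omega
    rcases abs_cases (Fv th (f + 1) s L B E - 2) with ha | ha <;> clear m1 p6 p7 h3 <;> omega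

end DotsAndBoxes

namespace DotsAndBoxes

/-- Excess of a component over its baseline. -/
def Component.ex : Component → ℕ
  | Component.chain n => n - 4
  | Component.loop n => n - 8

/-- Total excess. -/
def exc (G : Position) : ℕ := (G.map Component.ex).sum

/-- There is a long chain. -/
noncomputable def hasL (G : Position) : Bool :=
  @decide (∃ C ∈ G, C.isLongChain = true) (Classical.propDecidable _)

/-- There is a big loop. -/
noncomputable def hasB (G : Position) : Bool :=
  @decide (∃ C ∈ G, C.isBigLoop = true) (Classical.propDecidable _)

/-- Predicted value of a position. -/
noncomputable def FG (G : Position) : ℤ :=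
  Fv (theta G) (numF G) (numS G) (hasL G) (hasB G) (exc G)

theorem hasL_cons (C : Component) (G : Position) :
    hasL (C ::ₘ G) = (C.isLongChain || hasL G) := by
  rw [Bool.eq_iff_iff]; simp [hasL]

theorem hasB_cons (C : Component) (G : Position) :
    hasB (C ::ₘ G) = (C.isBigLoop || hasB G) := by
  rw [Bool.eq_iff_iff]; simp [hasB]

theorem exc_cons (C : Component) (G : Position) : exc (C ::ₘ G) = C.ex + exc G := by
  simp [exc]

theorem size_cons (C : Component) (G : Position) : size (C ::ₘ G) = C.size + size G := by
  simp [size]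

/-- Classification of valid components. -/
theorem valid_cases {C : Component} (h : C.Valid) :
    C = .chain 3 ∨ C = .loop 4 ∨ C = .loop 6 ∨ (∃ n, 4 ≤ n ∧ C = .chain n) ∨
      (∃ n, 8 ≤ n ∧ n % 2 = 0 ∧ C = .loop n) := by
  rcases C with n | n
  · simp only [Component.Valid] at h
    rcases (show n = 3 ∨ 4 ≤ n by omega) with h | h
    · simp [h]
    · right; right; right; left; exact ⟨n, h, rfl⟩
  · simp only [Component.Valid, Nat.even_iff] at h
    rcases (show n = 4 ∨ n = 6 ∨ 8 ≤ n by omega) with h1 | h1 | h1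
    · simp [h1]
    · simp [h1]
    · right; right; right; right; exact ⟨n, h1, h.2, rfl⟩

theorem valid_cons {C : Component} {G : Position} (h : Position.Valid (C ::ₘ G)) :
    C.Valid ∧ G.Valid :=
  ⟨h C (by simp), fun D hD => h D (by simp [hD])⟩

theorem ok_G (G : Position) (hG : G.Valid) :
    Ok (theta G) (numF G) (numS G) (hasL G) (hasB G) (exc G) := by
  induction G using Multiset.induction with
  | empty => simp [Ok, exc]
  | cons C G ih =>
    obtain ⟨hC, hG⟩ := valid_cons hG
    obtain ⟨h1, h2, h3, h4, h5, h6⟩ := ih hG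
    refine ⟨by positivity, by positivity, by positivity, by positivity, ?_, ?_⟩
    · rw [hasL_cons, exc_cons]
      rcases valid_cases hC with rfl | rfl | rfl | ⟨n, hn, rfl⟩ | ⟨n, hn, hn2, rfl⟩ <;>
        simp [Component.isLongChain, Component.ex] at * <;> try omega
      intro a
      have := h5 a
      omega
    · rw [hasL_cons, hasB_cons, exc_cons]
      rcases valid_cases hC with rfl | rfl | rfl | ⟨n, hn, rfl⟩ | ⟨n, hn, hn2, rfl⟩ <;>
        simp [Component.isLongChain, Component.isBigLoop, Component.ex] at * <;>
        first | omega | assumption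

theorem FG_T (G : Position) : FG (.chain 3 ::ₘ G) =
    Fv (theta G + 1) (numF G) (numS G) (hasL G) (hasB G) (exc G) := by
  simp [FG, theta, numF, numS, hasL_cons, hasB_cons, exc_cons, Component.isLongChain,
    Component.isBigLoop, Component.ex]

theorem FG_F (G : Position) : FG (.loop 4 ::ₘ G) =
    Fv (theta G) (numF G + 1) (numS G) (hasL G) (hasB G) (exc G) := by
  simp [FG, theta, numF, numS, hasL_cons, hasB_cons, exc_cons, Component.isLongChain,
    Component.isBigLoop, Component.ex]

theorem FG_S (G : Position) : FG (.loop 6 ::ₘ G) =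
    Fv (theta G) (numF G) (numS G + 1) (hasL G) (hasB G) (exc G) := by
  simp [FG, theta, numF, numS, hasL_cons, hasB_cons, exc_cons, Component.isLongChain,
    Component.isBigLoop, Component.ex]

theorem FG_L (G : Position) {n : ℕ} (hn : 4 ≤ n) : FG (.chain n ::ₘ G) =
    Fv (theta G) (numF G) (numS G) true (hasB G) (exc G + ((n : ℤ) - 4)) := by
  have h3 : (3 : ℕ) ≠ n := by omega
  simp [FG, theta, numF, numS, hasL_cons, hasB_cons, exc_cons, Component.isLongChain,
    Component.isBigLoop, Component.ex, hn, h3]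
  congr 1
  omega

theorem FG_B (G : Position) {n : ℕ} (hn : 8 ≤ n) : FG (.loop n ::ₘ G) =
    Fv (theta G) (numF G) (numS G) (hasL G) true (exc G + ((n : ℤ) - 8)) := by
  have h3 : (4 : ℕ) ≠ n := by omega
  have h4 : (6 : ℕ) ≠ n := by omega
  simp [FG, theta, numF, numS, hasL_cons, hasB_cons, exc_cons, Component.isLongChain,
    Component.isBigLoop, Component.ex, hn, h3, h4]
  congr 1
  omega

theorem FG_le (C : Component) (G : Position) (h : Position.Valid (C ::ₘ G)) :
    FG (C ::ₘ G) ≤ openVal C (FG G) := by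
  obtain ⟨hC, hG⟩ := valid_cons h
  have ho := ok_G G hG
  rcases valid_cases hC with rfl | rfl | rfl | ⟨n, hn, rfl⟩ | ⟨n, hn, hn2, rfl⟩
  · rw [FG_T]
    simpa [openVal, FG] using Fv_T_le ho
  · rw [FG_F]
    simpa [openVal, FG] using Fv_F_le ho
  · rw [FG_S]
    simpa [openVal, FG] using Fv_S_le ho
  · rw [FG_L G hn]
    simpa [openVal, FG] using Fv_L_le (n := n) ho (by omega)
  · rw [FG_B G hn]
    simpa [openVal, FG] using Fv_B_le (n := n) ho (by omega) (by omega)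

theorem hasL_iff (G : Position) : hasL G = true ↔ ∃ n, 4 ≤ n ∧ Component.chain n ∈ G := by
  simp only [hasL, decide_eq_true_eq]
  constructor
  · rintro ⟨C, hC, h⟩
    cases C with
    | chain n => exact ⟨n, by simpa [Component.isLongChain] using h, hC⟩
    | loop n => simp [Component.isLongChain] at h
  · rintro ⟨n, hn, h⟩
    exact ⟨_, h, by simpa [Component.isLongChain] using hn⟩

theorem hasB_iff (G : Position) : hasB G = true ↔ ∃ n, 8 ≤ n ∧ Component.loop n ∈ G := by
  simp only [hasB, decide_eq_true_eq]
  constructor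
  · rintro ⟨C, hC, h⟩
    cases C with
    | loop n => exact ⟨n, by simpa [Component.isBigLoop] using h, hC⟩
    | chain n => simp [Component.isBigLoop] at h
  · rintro ⟨n, hn, h⟩
    exact ⟨_, h, by simpa [Component.isBigLoop] using hn⟩

theorem theta_cons_ne {C : Component} (G : Position) (h : Component.chain 3 ≠ C) :
    theta (C ::ₘ G) = theta G := by simp [theta, h]

theorem numF_cons_ne {C : Component} (G : Position) (h : Component.loop 4 ≠ C) :
    numF (C ::ₘ G) = numF G := by simp [numF, h]

theorem numS_cons_ne {C : Component} (G : Position) (h : Component.loop 6 ≠ C) :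
    numS (C ::ₘ G) = numS G := by simp [numS, h]

theorem FG_opt (G : Position) (hG : G.Valid) (hne : G ≠ 0) :
    ∃ C H, G = C ::ₘ H ∧ openVal C (FG H) = FG G := by
  have memT : 0 < theta G → ∃ H, G = .chain 3 ::ₘ H := fun h =>
    Multiset.exists_cons_of_mem (Multiset.count_pos.1 h)
  have memF : 0 < numF G → ∃ H, G = .loop 4 ::ₘ H := fun h =>
    Multiset.exists_cons_of_mem (Multiset.count_pos.1 h)
  have memS : 0 < numS G → ∃ H, G = .loop 6 ::ₘ H := fun h =>
    Multiset.exists_cons_of_mem (Multiset.count_pos.1 h)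
  by_cases hF : 0 < numF G
  · obtain ⟨H, rfl⟩ := memF hF
    by_cases hT : 0 < theta (.loop 4 ::ₘ H)
    · rw [theta_cons_ne _ (by simp)] at hT
      obtain ⟨K, rfl⟩ := Multiset.exists_cons_of_mem (Multiset.count_pos.1 hT)
      have hK := (valid_cons (valid_cons hG).2).2
      have e1 : FG (.loop 4 ::ₘ .chain 3 ::ₘ K) = Fv (theta K + 1) (numF K + 1) (numS K)
          (hasL K) (hasB K) (exc K) := by
        rw [FG_F]
        simp [theta, numF, numS, hasL_cons, hasB_cons, exc_cons, Component.isLongChain,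
          Component.isBigLoop, Component.ex]
      rcases opt_TF (ok_G K hK) with h | h
      · refine ⟨.chain 3, .loop 4 ::ₘ K, Multiset.cons_swap _ _ _, ?_⟩
        rw [e1, FG_F, ← h]
        simp [openVal]
      · refine ⟨.loop 4, .chain 3 ::ₘ K, rfl, ?_⟩
        rw [e1, FG_T, ← h]
        simp [openVal]
    · refine ⟨.loop 4, H, rfl, ?_⟩
      rw [theta_cons_ne _ (by simp)] at hT
      rw [FG_F, Fv_F_eq (by left; simpa using hT)]
      simp [openVal, FG]
  · have hF0 : numF G = 0 := by omega
    by_cases hT : 0 < theta G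
    · obtain ⟨H, rfl⟩ := memT hT
      have hH := (valid_cons hG).2
      have ho := ok_G H hH
      rw [numF_cons_ne _ (by simp)] at hF0
      rw [hF0] at ho
      by_cases hx : 1 ≤ theta H ∨ hasL H = true ∨ (numS H = 0 ∧ hasB H = false)
      · refine ⟨.chain 3, H, rfl, ?_⟩
        rw [FG_T, hF0, Nat.cast_zero, ← opt_T ho (by
          rcases hx with h | h | h
          · left; omega
          · right; left; exact h
          · right; right; exact ⟨by simp [h.1], h.2⟩)]
        simp [openVal, FG, hF0]
      · push Not at hx
        obtain ⟨hx1, hx2, hx3⟩ := hx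
        have hT0 : theta H = 0 := by omega
        have hL0 : hasL H = false := by simpa using hx2
        by_cases hS : 0 < numS H
        · obtain ⟨K, rfl⟩ := Multiset.exists_cons_of_mem (Multiset.count_pos.1 hS)
          have hK := (valid_cons hH).2
          have ho := ok_G K hK
          rw [numF_cons_ne _ (by simp)] at hF0
          rw [theta_cons_ne _ (by simp)] at hT0
          have hL1 : hasL K = false := by
            simpa [hasL_cons, Component.isLongChain] using hL0
          rw [hF0, hT0, hL1] at ho
          have e1 : FG (.chain 3 ::ₘ .loop 6 ::ₘ K) = Fv 1 0 (numS K + 1)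
              false (hasB K) (exc K) := by
            rw [FG_T, theta_cons_ne _ (by simp), numF_cons_ne _ (by simp), hT0, hF0, hL0]
            simp [numS, hasB_cons, exc_cons, Component.isBigLoop, Component.ex]
          rcases opt_TS ho with h | h
          · refine ⟨.chain 3, .loop 6 ::ₘ K, rfl, ?_⟩
            rw [e1, FG_S, ← h]
            simp [openVal, hT0, hF0, hL1]
          · refine ⟨.loop 6, .chain 3 ::ₘ K, Multiset.cons_swap _ _ _, ?_⟩
            rw [e1, FG_T, ← h]
            simp [openVal, hT0, hF0, hL1]
        · have hS0 : numS H = 0 := by omega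
          have hB : hasB H = true := by
            have := hx3 hS0
            simpa using this
          obtain ⟨n, hn, hm⟩ := (hasB_iff H).1 hB
          obtain ⟨K, rfl⟩ := Multiset.exists_cons_of_mem hm
          obtain ⟨hn2, hK⟩ := valid_cons hH
          simp only [Component.Valid, Nat.even_iff] at hn2
          have hV : Position.Valid (.chain 3 ::ₘ K) := by
            intro D hD
            rcases Multiset.mem_cons.1 hD with rfl | hD
            · simp [Component.Valid]
            · exact hK D hD
          have ho := ok_G _ hV
          have e1 : theta (.chain 3 ::ₘ K) = 1 := by
            rw [theta_cons_ne _ (by simp)] at hT0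
            simpa [theta] using hT0
          have e2 : numF (.chain 3 ::ₘ K) = 0 := by
            rw [numF_cons_ne _ (by simp; omega)] at hF0
            rw [numF_cons_ne _ (by simp)]; exact hF0
          have e3 : numS (.chain 3 ::ₘ K) = 0 := by
            rw [numS_cons_ne _ (by simp; omega)] at hS0
            rw [numS_cons_ne _ (by simp)]; exact hS0
          have e4 : hasL (.chain 3 ::ₘ K) = false := by
            simpa [hasL_cons, Component.isLongChain] using hL0
          rw [e1, e2, e3, e4] at ho
          refine ⟨.loop n, .chain 3 ::ₘ K, Multiset.cons_swap _ _ _, ?_⟩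
          rw [Multiset.cons_swap, FG_B _ hn, e1, e2, e3, e4]
          have := opt_B1 (n := n) ho (by omega) (by omega)
          simp only [Nat.cast_one, Nat.cast_zero]
          rw [← this]
          simp [openVal, FG, e1, e2, e3, e4]
    · have hT0 : theta G = 0 := by omega
      by_cases hS : 0 < numS G
      · obtain ⟨H, rfl⟩ := memS hS
        have hH := (valid_cons hG).2
        have ho := ok_G H hH
        rw [numF_cons_ne _ (by simp)] at hF0
        rw [theta_cons_ne _ (by simp)] at hT0
        rw [hF0, hT0] at ho
        refine ⟨.loop 6, H, rfl, ?_⟩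
        rw [FG_S, hF0, hT0]
        have := opt_S ho
        simp only [Nat.cast_zero]
        rw [← this]
        simp [openVal, FG, hF0, hT0]
      · have hS0 : numS G = 0 := by omega
        by_cases hB : hasB G = true
        · obtain ⟨n, hn, hm⟩ := (hasB_iff G).1 hB
          obtain ⟨K, rfl⟩ := Multiset.exists_cons_of_mem hm
          have hK := (valid_cons hG).2
          have ho := ok_G K hK
          rw [theta_cons_ne _ (by simp)] at hT0
          rw [numF_cons_ne _ (by simp; omega)] at hF0
          rw [numS_cons_ne _ (by simp; omega)] at hS0
          rw [hT0, hF0, hS0] at ho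
          refine ⟨.loop n, K, rfl, ?_⟩
          rw [FG_B _ hn, hT0, hF0, hS0]
          have := opt_B0 (n := n) ho (by omega)
          simp only [Nat.cast_zero]
          rw [← this]
          simp [openVal, FG, hT0, hF0, hS0]
        · have hL : hasL G = true := by
            obtain ⟨C, hC⟩ := Multiset.exists_mem_of_ne_zero hne
            rcases valid_cases (hG C hC) with rfl | rfl | rfl | ⟨n, hn, rfl⟩ | ⟨n, hn, hn2, rfl⟩
            · exact absurd (Multiset.count_pos.2 hC) hT
            · exact absurd (Multiset.count_pos.2 hC) hF
            · exact absurd (Multiset.count_pos.2 hC) hS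
            · exact (hasL_iff G).2 ⟨n, hn, hC⟩
            · exact absurd ((hasB_iff G).2 ⟨n, hn, hC⟩) hB
          obtain ⟨n, hn, hm⟩ := (hasL_iff G).1 hL
          obtain ⟨K, rfl⟩ := Multiset.exists_cons_of_mem hm
          have hK := (valid_cons hG).2
          have ho := ok_G K hK
          rw [theta_cons_ne _ (by simp; omega)] at hT0
          rw [numF_cons_ne _ (by simp)] at hF0
          rw [numS_cons_ne _ (by simp)] at hS0
          have hB0 : hasB K = false := by
            simpa [hasB_cons, Component.isBigLoop] using hB
          rw [hT0, hF0, hS0, hB0] at ho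
          refine ⟨.chain n, K, rfl, ?_⟩
          rw [FG_L _ hn, hT0, hF0, hS0, hB0]
          have := opt_L (n := n) ho (by omega)
          simp only [Nat.cast_zero]
          rw [← this]
          simp [openVal, FG, hT0, hF0, hS0, hB0]

theorem valueAux_eq (n : ℕ) : ∀ G : Position, Multiset.card G = n → G.Valid →
    valueAux n G = FG G := by
  induction n with
  | zero =>
    intro G hc _
    rw [Multiset.card_eq_zero] at hc
    subst hc
    simp [valueAux, FG, theta, numF, numS, hasL, hasB, exc, Fv, Case3, base, fold8]
  | succ n ih =>
    intro G hc hG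
    have hne : G ≠ 0 := by rintro rfl; simp at hc
    rw [valueAux, if_neg hne]
    have hrec : ∀ C H, G = C ::ₘ H → valueAux n (G.erase C) = FG H := by
      rintro C H rfl
      rw [Multiset.erase_cons_head]
      exact ih H (by simpa using hc) (valid_cons hG).2
    apply IsLeast.csInf_eq
    constructor
    · obtain ⟨C, H, hGH, h⟩ := FG_opt G hG hne
      refine ⟨C, by simp [hGH], ?_⟩
      rw [hrec C H hGH, h]
    · rintro x ⟨C, hC, rfl⟩
      obtain ⟨H, hH⟩ := Multiset.exists_cons_of_mem hC
      rw [hrec C H hH]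
      rw [hH] at hG ⊢
      exact FG_le C H hG

theorem value_eq (G : Position) (hG : G.Valid) : value G = FG G := valueAux_eq _ G rfl hG

end DotsAndBoxes

namespace DotsAndBoxes

theorem numChains_chain (n : ℕ) (G : Position) :
    numChains (.chain n ::ₘ G) = numChains G + 1 := by
  rw [numChains, Multiset.filter_cons_of_pos _ (by simp [Component.isChain]), Multiset.card_cons]; rfl

theorem numChains_loop (n : ℕ) (G : Position) :
    numChains (.loop n ::ₘ G) = numChains G := by
  rw [numChains, Multiset.filter_cons_of_neg _ (by simp [Component.isChain])]; rfl

theorem numLoops_loop (n : ℕ) (G : Position) :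
    numLoops (.loop n ::ₘ G) = numLoops G + 1 := by
  rw [numLoops, Multiset.filter_cons_of_pos _ (by simp [Component.isLoop]), Multiset.card_cons]; rfl

theorem numLoops_chain (n : ℕ) (G : Position) :
    numLoops (.chain n ::ₘ G) = numLoops G := by
  rw [numLoops, Multiset.filter_cons_of_neg _ (by simp [Component.isLoop])]; rfl

theorem size_identity (G : Position) (hG : G.Valid) :
    (size G : ℤ) - 4 * numChains G - 8 * numLoops G
      = exc G - theta G - 4 * numF G - 2 * numS G := by
  induction G using Multiset.induction with
  | empty => simp [size, numChains, numLoops, exc, theta, numF, numS]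
  | cons C G ih =>
    obtain ⟨hC, hG⟩ := valid_cons hG
    have ih := ih hG
    rw [size_cons, exc_cons]
    rcases valid_cases hC with rfl | rfl | rfl | ⟨n, hn, rfl⟩ | ⟨n, hn, hn2, rfl⟩
    · simp [numChains_chain, numChains_loop, numLoops_chain, numLoops_loop, theta, numF, numS, Component.size,
        Component.ex] at *
      omega
    · simp [numChains_chain, numChains_loop, numLoops_chain, numLoops_loop, theta, numF, numS, Component.size,
        Component.ex] at *
      omega
    · simp [numChains_chain, numChains_loop, numLoops_chain, numLoops_loop, theta, numF, numS, Component.size,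
        Component.ex] at *
      omega
    · have h3 : (3 : ℕ) ≠ n := by omega
      simp [numChains_chain, numChains_loop, numLoops_chain, numLoops_loop, theta, numF, numS, Component.size,
        Component.ex, h3] at *
      omega
    · have h3 : (4 : ℕ) ≠ n := by omega
      have h4 : (6 : ℕ) ≠ n := by omega
      simp [numChains_chain, numChains_loop, numLoops_chain, numLoops_loop, theta, numF, numS, Component.size,
        Component.ex, h3, h4] at *
      omega

theorem theta_pos (G : Position) : 0 < theta G ↔ Component.chain 3 ∈ G := Multiset.count_pos

theorem numF_pos (G : Position) : 0 < numF G ↔ Component.loop 4 ∈ G := Multiset.count_pos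

theorem numS_pos (G : Position) : 0 < numS G ↔ Component.loop 6 ∈ G := Multiset.count_pos

theorem exists_loop_iff (G : Position) (hG : G.Valid) :
    (∃ C ∈ G, C.isLoop = true) ↔ (0 < numF G ∨ 0 < numS G ∨ hasB G = true) := by
  rw [numF_pos, numS_pos, hasB_iff]
  constructor
  · rintro ⟨C, hC, h⟩
    rcases valid_cases (hG C hC) with rfl | rfl | rfl | ⟨n, hn, rfl⟩ | ⟨n, hn, hn2, rfl⟩
    · simp [Component.isLoop] at h
    · exact Or.inl hC
    · exact Or.inr (Or.inl hC)
    · simp [Component.isLoop] at h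
    · exact Or.inr (Or.inr ⟨n, hn, hC⟩)
  · rintro (h | h | ⟨n, _, h⟩) <;> exact ⟨_, h, rfl⟩

theorem all_chain3_iff (G : Position) (hG : G.Valid) :
    (∀ C ∈ G, C.isChain = true → C = Component.chain 3) ↔ hasL G = false := by
  rw [← Bool.not_eq_true, hasL_iff]
  constructor
  · rintro h ⟨n, hn, hC⟩
    have := h _ hC rfl
    simp at this
    omega
  · intro h C hC hc
    rcases valid_cases (hG C hC) with rfl | rfl | rfl | ⟨n, hn, rfl⟩ | ⟨n, hn, hn2, rfl⟩
    · rfl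
    · simp [Component.isChain] at hc
    · simp [Component.isChain] at hc
    · exact absurd ⟨n, hn, hC⟩ h
    · simp [Component.isChain] at hc

theorem all_loop_iff (G : Position) (hG : G.Valid) :
    (∀ C ∈ G, C.isLoop = true) ↔ (theta G = 0 ∧ hasL G = false) := by
  rw [← Bool.not_eq_true, hasL_iff]
  constructor
  · intro h
    constructor
    · by_contra h0
      have := h _ ((theta_pos G).1 (by omega))
      simp [Component.isLoop] at this
    · rintro ⟨n, hn, hC⟩
      have := h _ hC
      simp [Component.isLoop] at this
  · rintro ⟨h0, h⟩ C hC
    rcases valid_cases (hG C hC) with rfl | rfl | rfl | ⟨n, hn, rfl⟩ | ⟨n, hn, hn2, rfl⟩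
    · have := (theta_pos G).2 hC
      omega
    · rfl
    · rfl
    · exact absurd ⟨n, hn, hC⟩ h
    · rfl

theorem tb_eq (G : Position) (hG : G.Valid) :
    tb G = tbv (theta G) (numF G) (numS G) (hasL G) (hasB G) := by
  unfold tb
  by_cases h0 : G = 0
  · subst h0
    simp [tbv, theta, numF, numS, hasL, hasB]
  · rw [if_neg h0]
    simp only [all_loop_iff G hG, exists_loop_iff G hG, all_chain3_iff G hG, ← theta_pos]
    have hex : (theta G = 0 ∧ hasL G = false) → (0 < numF G ∨ 0 < numS G ∨ hasB G = true) := by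
      intro h
      rw [← all_loop_iff G hG] at h
      obtain ⟨C, hC⟩ := Multiset.exists_mem_of_ne_zero h0
      exact (exists_loop_iff G hG).1 ⟨C, hC, h C hC⟩
    unfold tbv
    simp only [Nat.cast_pos, Nat.cast_eq_zero]
    cases hL : hasL G
    · rcases Nat.eq_zero_or_pos (theta G) with h | h
      · simp [h, hex ⟨h, hL⟩]
      · have h' : theta G ≠ 0 := by omega
        simp [h, h']
    · simp

theorem cval_eq (G : Position) (hG : G.Valid) :
    cval G = cv (theta G) (numF G) (numS G) (hasL G) (hasB G) (exc G) := by
  rw [cval, size_identity G hG, tb_eq G hG, cv]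

theorem exceptional_iff (G : Position) (hG : G.Valid) :
    G = Component.loop 4 ::ₘ Component.chain 3 ::ₘ {Component.chain 3} ↔
      (numF G = 1 ∧ theta G = 2 ∧ numS G = 0 ∧ hasL G = false ∧ hasB G = false) := by
  constructor
  · rintro rfl
    refine ⟨by decide, by decide, by decide, ?_, ?_⟩
    · simp [hasL, Component.isLongChain]
    · simp [hasB, Component.isBigLoop]
  · rintro ⟨h1, h2, h3, h4, h5⟩
    ext C
    by_cases hv : C.Valid
    · rcases valid_cases hv with rfl | rfl | rfl | ⟨n, hn, rfl⟩ | ⟨n, hn, hn2, rfl⟩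
      · exact h2.trans (by decide)
      · exact h1.trans (by decide)
      · exact h3.trans (by decide)
      · have hm : Component.chain n ∉ G := fun hm => by
          rw [(hasL_iff G).2 ⟨n, hn, hm⟩] at h4; cases h4
        rw [Multiset.count_eq_zero_of_notMem hm, Multiset.count_eq_zero_of_notMem]
        simp; omega
      · have hm : Component.loop n ∉ G := fun hm => by
          rw [(hasB_iff G).2 ⟨n, hn, hm⟩] at h5; cases h5
        rw [Multiset.count_eq_zero_of_notMem hm, Multiset.count_eq_zero_of_notMem]
        simp; omega
    · rw [Multiset.count_eq_zero_of_notMem (fun h => hv (hG C h)),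
        Multiset.count_eq_zero_of_notMem]
      intro h
      apply hv
      simp at h
      rcases h with rfl | rfl
      · exact ⟨by norm_num, by decide⟩
      · simp [Component.Valid]

theorem exc_filter (p : Component → Prop) [DecidablePred p] (G : Position)
    (h : ∀ C ∈ G, ¬ p C → C.ex = 0) : exc (G.filter p) = exc G := by
  induction G using Multiset.induction with
  | empty => simp
  | cons C G ih =>
    have ih := ih fun D hD => h D (by simp [hD])
    rw [exc_cons]
    by_cases hp : p C
    · rw [Multiset.filter_cons_of_pos _ hp, exc_cons, ih]
    · rw [Multiset.filter_cons_of_neg _ hp, ih, h C (by simp) hp, zero_add]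

theorem core_true (G : Position) (h : hasL G = true) : core G =
    G.filter fun C => C.isBigLoop = true ∨ C.isLongChain = true := by
  have : ∃ C ∈ G, C.isLongChain = true := by simpa [hasL] using h
  rw [core, if_pos this]

theorem core_false (G : Position) (h : hasL G = false) : core G =
    G.filter fun C => C.isBigLoop = true ∨ C = Component.chain 3 := by
  have : ¬ ∃ C ∈ G, C.isLongChain = true := by simpa [hasL] using h
  rw [core, if_neg this]

theorem core_le (G : Position) : core G ≤ G := by
  rw [core]
  split_ifs <;> exact Multiset.filter_le _ _

theorem core_valid (G : Position) (hG : G.Valid) : (core G).Valid :=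
  fun C hC => hG C (Multiset.mem_of_le (core_le G) hC)

theorem hasB_core (G : Position) : hasB (core G) = hasB G := by
  rw [Bool.eq_iff_iff, hasB_iff, hasB_iff]
  cases h : hasL G
  · rw [core_false G h]
    refine exists_congr fun n => and_congr_right fun hn => ?_
    rw [Multiset.mem_filter]
    simp [Component.isBigLoop, hn]
  · rw [core_true G h]
    refine exists_congr fun n => and_congr_right fun hn => ?_
    rw [Multiset.mem_filter]
    simp [Component.isBigLoop, hn]

theorem hasL_core (G : Position) : hasL (core G) = hasL G := by
  cases h : hasL G
  · rw [← Bool.not_eq_true] at h ⊢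
    rw [hasL_iff] at h ⊢
    rintro ⟨n, hn, hm⟩
    exact h ⟨n, hn, Multiset.mem_of_le (core_le G) hm⟩
  · obtain ⟨n, hn, hm⟩ := (hasL_iff G).1 h
    rw [hasL_iff, core_true G h]
    exact ⟨n, hn, by rw [Multiset.mem_filter]; simp [Component.isLongChain, hn, hm]⟩

theorem numF_core (G : Position) : numF (core G) = 0 := by
  rw [numF, Multiset.count_eq_zero]
  cases h : hasL G
  · rw [core_false G h, Multiset.mem_filter]; simp [Component.isBigLoop]
  · rw [core_true G h, Multiset.mem_filter]; simp [Component.isBigLoop, Component.isLongChain]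

theorem numS_core (G : Position) : numS (core G) = 0 := by
  rw [numS, Multiset.count_eq_zero]
  cases h : hasL G
  · rw [core_false G h, Multiset.mem_filter]; simp [Component.isBigLoop]
  · rw [core_true G h, Multiset.mem_filter]; simp [Component.isBigLoop, Component.isLongChain]

theorem theta_core_true (G : Position) (h : hasL G = true) : theta (core G) = 0 := by
  rw [theta, Multiset.count_eq_zero, core_true G h, Multiset.mem_filter]
  simp [Component.isBigLoop, Component.isLongChain]

theorem theta_core_false (G : Position) (h : hasL G = false) : theta (core G) = theta G := by
  rw [theta, core_false G h, Multiset.count_filter_of_pos (by simp)]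
  rfl

theorem exc_core (G : Position) (hG : G.Valid) : exc (core G) = exc G := by
  cases h : hasL G
  · rw [core_false G h]
    apply exc_filter
    intro C hC hp
    rcases valid_cases (hG C hC) with rfl | rfl | rfl | ⟨n, hn, rfl⟩ | ⟨n, hn, hn2, rfl⟩
    · rfl
    · rfl
    · rfl
    · rw [(hasL_iff G).2 ⟨n, hn, hC⟩] at h; cases h
    · simp [Component.isBigLoop] at hp; omega
  · rw [core_true G h]
    apply exc_filter
    intro C hC hp
    rcases valid_cases (hG C hC) with rfl | rfl | rfl | ⟨n, hn, rfl⟩ | ⟨n, hn, hn2, rfl⟩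
    · rfl
    · rfl
    · rfl
    · simp [Component.isBigLoop, Component.isLongChain] at hp; omega
    · simp [Component.isBigLoop, Component.isLongChain] at hp; omega

theorem thetaPrime_eq (G : Position) :
    thetaPrime G = theta G - theta (core G) := by
  rw [thetaPrime, theta, Multiset.count_sub]
  rfl

theorem sig_iter (x : ℤ) (hx : 2 ≤ x) (s : ℕ) : SigOp^[s] x = sat x s := by
  induction s with
  | zero => simp [sat]
  | succ s ih =>
    rw [Function.iterate_succ_apply', ih, Nat.cast_succ, sat_step x s hx (by positivity)]
    rfl

theorem sig_iter_zero (s : ℕ) : SigOp^[s] 0 = if 0 < s then sat 8 s else 0 := by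
  cases s with
  | zero => rfl
  | succ s =>
    rw [if_pos (by omega), ← sig_iter 8 (by norm_num)]
    rw [Function.iterate_succ_apply, Function.iterate_succ_apply]
    rfl

theorem phi_iter (y : ℤ) (hy : 0 ≤ y) (f : ℕ) : PhiOp^[f] y = fold8 (y - 4 * f) := by
  induction f with
  | zero => simp [fold8, hy]
  | succ f ih =>
    rw [Function.iterate_succ_apply', ih]
    have : y - 4 * ((f + 1 : ℕ) : ℤ) = (y - 4 * f) - 4 := by push_cast; ring
    rw [this, fold8_step]
    rfl

theorem procedural_eq (G : Position) (hG : G.Valid) (h : theta G = 0 ∨ theta G = 1) :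
    ThetaOp^[thetaPrime G] (SigOp^[numS G] (cval (core G))) =
      base (theta G) (numS G) (hasL G) (hasB G) (exc G) := by
  obtain ⟨o1, o2, o3, o4, o5, o6⟩ := ok_G G hG
  rw [cval_eq _ (core_valid G hG), thetaPrime_eq, numF_core, numS_core, hasL_core, hasB_core,
    exc_core G hG]
  cases hL : hasL G
  · rw [theta_core_false G hL, Nat.sub_self, Function.iterate_zero, id_eq]
    cases hB : hasB G
    · have hE := o6 hL hB
      rw [hE]
      rcases h with h | h
      · simp [h, cv, tbv, base, sig_iter_zero]
      · simp [h, cv, tbv, base]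
        exact sig_iter 3 (by norm_num) _
    · rcases h with h | h
      · simp [h, cv, tbv, base]
        exact sig_iter _ (by omega) _
      · simp [h, cv, tbv, base]
        rw [sig_iter _ (by omega)]
        congr 1
        ring
  · rw [theta_core_true G hL]
    simp only [cv, tbv, base]
    rcases h with h | h
    · simp [h]
      exact sig_iter _ (by omega) _
    · simp [h, ThetaOp]
      exact sig_iter _ (by omega) _

/-- Procedural values: (1) if c(G) ≥ 2 then v = c; (2) if c(G) = 0, G has a 4-loop and
G ≠ 4ₗ+3+3 then v = 0; (3) if θ(G) = 0, or θ(G) = 1 and size(G) ≡ 3 mod 4, then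
v = Φ^f(Θ^θ′(Σ^s(c(G₀)))); in all other cases v = 1 or 2 by parity. -/
theorem values_procedural (G : Position) (hG : G.Valid) (hne : G ≠ 0) :
    (2 ≤ cval G → value G = cval G) ∧
    ((cval G = 0 ∧ Component.loop 4 ∈ G ∧
        G ≠ Component.loop 4 ::ₘ Component.chain 3 ::ₘ {Component.chain 3}) →
      value G = 0) ∧
    ((theta G = 0 ∨ (theta G = 1 ∧ size G % 4 = 3)) →
      value G = PhiOp^[numF G] (ThetaOp^[thetaPrime G] (SigOp^[numS G] (cval (core G))))) ∧
    ((¬ 2 ≤ cval G ∧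
      ¬ (cval G = 0 ∧ Component.loop 4 ∈ G ∧
          G ≠ Component.loop 4 ::ₘ Component.chain 3 ::ₘ {Component.chain 3}) ∧
      ¬ (theta G = 0 ∨ (theta G = 1 ∧ size G % 4 = 3))) →
      (Odd (size G) → value G = 1) ∧ (Even (size G) → value G = 2)) := by
  have hs := size_identity G hG
  have ho := ok_G G hG
  have hmod : (theta G = 0 ∨ (theta G = 1 ∧ size G % 4 = 3)) ↔
      Case3 (theta G) (numS G) (exc G) := by
    unfold Case3
    omega
  have hexc : (cval G = 0 ∧ Component.loop 4 ∈ G ∧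
        G ≠ Component.loop 4 ::ₘ Component.chain 3 ::ₘ {Component.chain 3}) ↔
      (cv (theta G) (numF G) (numS G) (hasL G) (hasB G) (exc G) = 0 ∧ (0 : ℤ) < numF G ∧
        ¬ ((numF G : ℤ) = 1 ∧ (theta G : ℤ) = 2 ∧ (numS G : ℤ) = 0 ∧ hasL G = false ∧
          hasB G = false)) := by
    rw [cval_eq G hG, ne_eq, exceptional_iff G hG, ← numF_pos]
    norm_cast
  rw [hmod, hexc, cval_eq G hG, value_eq G hG]
  obtain ⟨s1, s2, s3, s4, s5, s6, s7, s8, s9, s10, s11⟩ := Fv_spec ho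
  refine ⟨s4, s10, ?_, ?_⟩
  · intro h
    have hth : theta G = 0 ∨ theta G = 1 := by
      rw [← hmod] at h
      omega
    rw [procedural_eq G hG hth, phi_iter, FG, Fv, if_pos h]
    have := base_spec ho h
    omega
  · rintro ⟨h1, h2, h3⟩
    have hr := s11 (by omega) h2 h3
    have hp : (size G : ℤ) % 2 = ((exc G : ℤ) - theta G) % 2 := by omega
    rw [← s3] at hp
    rw [FG]
    constructor
    · intro h
      rw [Nat.odd_iff] at h
      omega
    · intro h
      rw [Nat.even_iff] at h
      omega

end DotsAndBoxes
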